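/- For nonnegative integers k₀, k₁, k₂ with k₀ + 2k₁ + 3k₂ = l, the element b = (k₁, k₂, k₂, k₂, k₂, k₁) is the unique element of B(l) satisfying ε₀(b) = k₀, ε₁(b) = k₁ and ε₂(b) = k₂. -/

import Mathlib

structure V where
  x1 : ℤ
  x2 : ℤ
  x3 : ℤ
  xb3 : ℤ
  xb2 : ℤ
  xb1 : ℤ
deriving DecidableEq

/-- Membership in the perfect crystal `B(l)`: all entries nonnegative,
`x₃ ≡ x̄₃ (mod 2)` and `s(b) ≤ l`. -/
def inB (l : ℤ) (b : V) : Prop :=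
  0 ≤ b.x1 ∧ 0 ≤ b.x2 ∧ 0 ≤ b.x3 ∧ 0 ≤ b.xb3 ∧ 0 ≤ b.xb2 ∧ 0 ≤ b.xb1 ∧
  b.x3 % 2 = b.xb3 % 2 ∧
  b.x1 + b.x2 + (b.x3 + b.xb3) / 2 + b.xb2 + b.xb1 ≤ l

def sB (b : V) : ℤ := b.x1 + b.x2 + (b.x3 + b.xb3) / 2 + b.xb2 + b.xb1
def tB (b : V) : ℤ := b.x2 + (b.x3 + b.xb3) / 2
def z1 (b : V) : ℤ := b.xb1 - b.x1
def z2 (b : V) : ℤ := b.xb2 - b.xb3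
def z3 (b : V) : ℤ := b.x3 - b.x2
def z4 (b : V) : ℤ := (b.xb3 - b.x3) / 2
def maxA (b : V) : ℤ :=
  max 0 (max (z1 b) (max (z1 b + z2 b) (max (z1 b + z2 b + 3 * z4 b)
    (max (z1 b + z2 b + z3 b + 3 * z4 b) (2 * z1 b + z2 b + z3 b + 3 * z4 b)))))
def eps1 (b : V) : ℤ := b.xb1 + max (b.xb3 - b.xb2 + max (b.x2 - b.x3) 0) 0
def phi1 (b : V) : ℤ := b.x1 + max (b.x3 - b.x2 + max (b.xb2 - b.xb3) 0) 0
def eps2 (b : V) : ℤ := b.xb2 + max (b.x3 - b.xb3) 0 / 2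
def phi2 (b : V) : ℤ := b.x2 + max (b.xb3 - b.x3) 0 / 2
def eps0 (l : ℤ) (b : V) : ℤ :=
  l - sB b + maxA b - (2 * z1 b + z2 b + z3 b + 3 * z4 b)
def phi0 (l : ℤ) (b : V) : ℤ := l - sB b + maxA b
def f2 (b : V) : V :=
  if z4 b ≤ 0 then ⟨b.x1, b.x2 - 1, b.x3 + 2, b.xb3, b.xb2, b.xb1⟩
  else ⟨b.x1, b.x2, b.x3, b.xb3 - 2, b.xb2 + 1, b.xb1⟩
def e2 (b : V) : V :=
  if 0 ≤ z4 b then ⟨b.x1, b.x2, b.x3, b.xb3 + 2, b.xb2 - 1, b.xb1⟩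
  else ⟨b.x1, b.x2 + 1, b.x3 - 2, b.xb3, b.xb2, b.xb1⟩
def f1 (b : V) : V :=
  if max (z2 b) 0 ≤ -z3 b then ⟨b.x1 - 1, b.x2 + 1, b.x3, b.xb3, b.xb2, b.xb1⟩
  else if z2 b ≤ 0 ∧ 0 < z3 b then ⟨b.x1, b.x2, b.x3 - 1, b.xb3 + 1, b.xb2, b.xb1⟩
  else ⟨b.x1, b.x2, b.x3, b.xb3, b.xb2 - 1, b.xb1 + 1⟩
def e1 (b : V) : V :=
  if max (-z3 b) 0 ≤ z2 b then ⟨b.x1, b.x2, b.x3, b.xb3, b.xb2 + 1, b.xb1 - 1⟩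
  else if z2 b < 0 ∧ 0 ≤ z3 b then ⟨b.x1, b.x2, b.x3 + 1, b.xb3 - 1, b.xb2, b.xb1⟩
  else ⟨b.x1 + 1, b.x2 - 1, b.x3, b.xb3, b.xb2, b.xb1⟩

theorem stmt6 (l : ℤ) (hl : 0 < l) (k0 k1 k2 : ℤ)
    (h0 : 0 ≤ k0) (h1 : 0 ≤ k1) (h2 : 0 ≤ k2)
    (hsum : k0 + 2 * k1 + 3 * k2 = l) :
    inB l ⟨k1, k2, k2, k2, k2, k1⟩ ∧
    eps0 l ⟨k1, k2, k2, k2, k2, k1⟩ = k0 ∧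
    eps1 ⟨k1, k2, k2, k2, k2, k1⟩ = k1 ∧
    eps2 ⟨k1, k2, k2, k2, k2, k1⟩ = k2 ∧
    ∀ b : V, inB l b → eps0 l b = k0 → eps1 b = k1 → eps2 b = k2 →
      b = ⟨k1, k2, k2, k2, k2, k1⟩ := by
  refine ⟨?_, ?_, ?_, ?_, ?_⟩
  · refine ⟨h1, h2, h2, h2, h2, h1, rfl, ?_⟩
    dsimp only
    omega
  · simp only [eps0, sB, maxA, z1, z2, z3, z4]
    simp only [sub_self, Int.zero_ediv, mul_zero, add_zero, max_self]
    omega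
  · simp only [eps1]
    omega
  · simp only [eps2]
    omega
  · rintro ⟨x1, x2, x3, y3, y2, y1⟩ hB he0 he1 he2
    have hM := le_refl (maxA ⟨x1, x2, x3, y3, y2, y1⟩)
    nth_rewrite 1 [maxA] at hM
    simp only [max_le_iff] at hM
    simp only [eps0] at he0
    generalize maxA ⟨x1, x2, x3, y3, y2, y1⟩ = M at hM he0
    simp only [inB, eps1, eps2, sB, z1, z2, z3, z4] at hB hM he0 he1 he2
    obtain ⟨hx1, hx2, hx3, hy3, hy2, hy1, hpar, -⟩ := hB
    obtain ⟨d, hd⟩ : ∃ d, x3 = y3 + 2 * d := ⟨(x3 - y3) / 2, by omega⟩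
    subst hd
    have hs : (y3 + 2 * d + y3) / 2 = y3 + d := by omega
    have hz : (y3 - (y3 + 2 * d)) / 2 = -d := by omega
    have hm : max (y3 + 2 * d - y3) 0 / 2 = max d 0 := by omega
    rw [hs, hz] at he0
    rw [hz] at hM
    obtain ⟨hM1, hM2, -, hM4, hM5, hM6⟩ := hM
    rw [hm] at he2
    generalize hp : max (y3 - y2 + max (x2 - (y3 + 2 * d)) 0) 0 = p at he1
    have hp0 : 0 ≤ p := by omega
    have hp1 : y3 - y2 ≤ p := by omega
    have hp2 : y3 - y2 + (x2 - (y3 + 2 * d)) ≤ p := by omega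
    generalize hq : max d 0 = q at he2
    have hq0 : 0 ≤ q := hq ▸ le_max_right d 0
    have hq1 : d ≤ q := hq ▸ le_max_left d 0
    clear hp hq hm hs hz
    have h : x1 = k1 ∧ x2 = k2 ∧ y3 = k2 ∧ d = 0 ∧ y2 = k2 ∧ y1 = k1 := by
      have hp : p = 0 := by linarith
      have hq : q = 0 := by linarith
      omega
    obtain ⟨rfl, rfl, rfl, rfl, hy, rfl⟩ := h
    simp [hy]
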